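/- arXiv:2108.01410 — 2 statements merged into one kernel-verified Lean document; each statement's English description precedes it below -/
import Mathlib

section
/- Let G be a finite connected simple graph with edge set E that is 2-edge-connected (deleting any single edge leaves it connected). Let P_U = conv{1_{E∖T} : T the edge set of a spanning tree of G} ⊆ ℝ^E and Δ_E = conv{e_e : e ∈ E}. Then every edge (one-dimensional face) of the Minkowski sum P_F = P_U + Δ_E is parallel to a difference e_i − e_j of standard basis vectors with i ≠ j; in particular the edges of P_F are parallel to columns of a unimodular matrix. -/
open scoped Pointwise
open Classical

noncomputable section

/-- `T` is the edge set of a spanning tree of `G`. -/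
def IsSpanningTreeEdges {V : Type*} (G : SimpleGraph V) (T : Set (Sym2 V)) : Prop :=
  T ⊆ G.edgeSet ∧ (SimpleGraph.fromEdgeSet T).IsTree

/-- `F` is the edge set of a spanning two-forest of `G`: a spanning subgraph that is
acyclic and has exactly two connected components. -/
def IsSpanningTwoForestEdges {V : Type*} (G : SimpleGraph V) (F : Set (Sym2 V)) : Prop :=
  F ⊆ G.edgeSet ∧ (SimpleGraph.fromEdgeSet F).IsAcyclic ∧
    Nat.card (SimpleGraph.fromEdgeSet F).ConnectedComponent = 2

/-- The indicator vector of `E ∖ S` in `ℝ^E`, where `E` is the edge set of `G`. -/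
def coIndicator {V : Type*} (G : SimpleGraph V) (S : Set (Sym2 V)) : G.edgeSet → ℝ :=
  fun e => if (e : Sym2 V) ∈ S then 0 else 1

/-- The standard basis vector indexed by `f`. -/
def stdVec {ι : Type*} (f : ι) : ι → ℝ := fun e => if e = f then 1 else 0

/-- `x` is a lattice point (all coordinates are integers). -/
def IsLatticePt {ι : Type*} (x : ι → ℝ) : Prop := ∀ i, ∃ n : ℤ, x i = (n : ℝ)

/-- The integer decomposition property for a set `P ⊆ ℝ^ι`. -/
def HasIDP {ι : Type*} (P : Set (ι → ℝ)) : Prop :=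
  ∀ k : ℕ, 1 ≤ k →
    ((k : ℝ) • P) ∩ {x | IsLatticePt x} =
      ((((k - 1 : ℕ) : ℝ) • P) ∩ {x | IsLatticePt x}) + (P ∩ {x | IsLatticePt x})

namespace SimpleGraph

variable {V : Type*}

/-- A graph is connected if it joins the endpoints of every edge of some connected graph. -/
lemma Connected.of_forall_adj_reachable {H K : SimpleGraph V} (hH : H.Connected)
    (h : ∀ x y, H.Adj x y → K.Reachable x y) : K.Connected := by
  have := hH.nonempty
  refine ⟨fun x y => ?_⟩
  obtain ⟨p⟩ := hH.preconnected x y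
  induction p with
  | nil => rfl
  | cons hadj _ ih => exact (h _ _ hadj).trans ih

/-- Deleting an edge from a connected graph leaves every vertex reachable from one of the
endpoints of that edge. -/
lemma reachable_or_reachable_of_connected_fromEdgeSet {T : Set (Sym2 V)}
    (hT : (fromEdgeSet T).Connected) (a b x : V) :
    (fromEdgeSet (T \ {s(a, b)})).Reachable x a ∨
      (fromEdgeSet (T \ {s(a, b)})).Reachable x b := by
  obtain ⟨p⟩ := hT.preconnected x a
  induction p with
  | nil => exact Or.inl .rfl
  | @cons u v w hadj _ ih =>
    by_cases he : s(u, v) = s(w, b)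
    · rcases Sym2.eq_iff.1 he with ⟨rfl, -⟩ | ⟨rfl, -⟩
      · exact Or.inl .rfl
      · exact Or.inr .rfl
    · have huv : (fromEdgeSet (T \ {s(w, b)})).Reachable u v := by
        refine Adj.reachable ?_
        rw [fromEdgeSet_adj] at hadj ⊢
        exact ⟨⟨hadj.1, he⟩, hadj.2⟩
      exact ih.imp huv.trans huv.trans

lemma Connected.fromEdgeSet_exchange {T : Set (Sym2 V)} (hT : (fromEdgeSet T).Connected)
    {a b : V} {f : Sym2 V}
    (h : (fromEdgeSet (insert f (T \ {s(a, b)}))).Reachable a b) :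
    (fromEdgeSet (insert f (T \ {s(a, b)}))).Connected := by
  refine hT.of_forall_adj_reachable fun x y hxy => ?_
  rw [fromEdgeSet_adj] at hxy
  by_cases he : s(x, y) = s(a, b)
  · rcases Sym2.eq_iff.1 he with ⟨rfl, rfl⟩ | ⟨rfl, rfl⟩
    · exact h
    · exact h.symm
  · refine Adj.reachable ?_
    rw [fromEdgeSet_adj]
    exact ⟨Or.inr ⟨hxy.1, he⟩, hxy.2⟩

end SimpleGraph

open SimpleGraph in
lemma IsSpanningTreeEdges.ncard_add_one {V : Type*} [Fintype V] {G : SimpleGraph V}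
    {T : Set (Sym2 V)} (hT : IsSpanningTreeEdges G T) : T.ncard + 1 = Nat.card V := by
  have h := (isTree_iff_connected_and_card.1 hT.2).2
  rwa [edgeSet_fromEdgeSet, Nat.card_coe_set_eq, sdiff_eq_left.2] at h
  exact Set.subset_compl_iff_disjoint_right.1 (hT.1.trans G.edgeSet_subset_compl_diagSet)

open SimpleGraph in
/-- Exchanging an edge of a spanning tree for a new edge gives a spanning tree as soon as the
result joins the endpoints of the removed edge. -/
lemma IsSpanningTreeEdges.exchange {V : Type*} [Fintype V] {G : SimpleGraph V}
    {T : Set (Sym2 V)} (hT : IsSpanningTreeEdges G T) {a b : V} {f : Sym2 V}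
    (he : s(a, b) ∈ T) (hf : f ∉ T) (hfG : f ∈ G.edgeSet)
    (h : (fromEdgeSet (insert f (T \ {s(a, b)}))).Reachable a b) :
    IsSpanningTreeEdges G (insert f (T \ {s(a, b)})) := by
  have hsub : insert f (T \ {s(a, b)}) ⊆ G.edgeSet :=
    Set.insert_subset hfG (Set.sdiff_subset.trans hT.1)
  refine ⟨hsub, isTree_iff_connected_and_card.2 ⟨hT.2.connected.fromEdgeSet_exchange h, ?_⟩⟩
  rw [edgeSet_fromEdgeSet, Nat.card_coe_set_eq, sdiff_eq_left.2, Set.ncard_exchange hf he,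
    hT.ncard_add_one]
  exact Set.subset_compl_iff_disjoint_right.1 (hsub.trans G.edgeSet_subset_compl_diagSet)

open SimpleGraph in
/-- The symmetric exchange property of spanning trees. -/
lemma IsSpanningTreeEdges.symmetric_exchange {V : Type*} [Fintype V] {G : SimpleGraph V}
    {T T' : Set (Sym2 V)} (hT : IsSpanningTreeEdges G T) (hT' : IsSpanningTreeEdges G T')
    {e : Sym2 V} (he : e ∈ T) (he' : e ∉ T') :
    ∃ f ∈ T', f ∉ T ∧ IsSpanningTreeEdges G (insert f (T \ {e})) ∧
      IsSpanningTreeEdges G (insert e (T' \ {f})) := by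
  induction e using Sym2.ind with | _ a b
  have hne : a ≠ b := G.ne_of_adj (hT.1 he)
  have hsep : ¬ (fromEdgeSet (T \ {s(a, b)})).Reachable a b := by
    have h := isAcyclic_iff_forall_adj_isBridge.1 hT.2.isAcyclic
      ((fromEdgeSet_adj T).2 ⟨he, hne⟩)
    rw [isBridge_iff] at h
    refine fun hr => h (hr.mono fun x y hxy => ?_)
    rw [fromEdgeSet_adj] at hxy
    rw [deleteEdges_adj, fromEdgeSet_adj]
    exact ⟨⟨hxy.1.1, hxy.2⟩, hxy.1.2⟩
  obtain ⟨p, hp⟩ := hT'.2.connected.exists_isPath a b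
  obtain ⟨⟨⟨c, d⟩, hcd⟩, hdp, hc, hd⟩ := p.exists_boundary_dart
    {x | (fromEdgeSet (T \ {s(a, b)})).Reachable a x} .rfl hsep
  simp only [Set.mem_ofPred_eq] at hc hd
  have hcd' := hcd
  simp only [fromEdgeSet_adj] at hcd'
  have hfp : s(c, d) ∈ p.edges := List.mem_map.2 ⟨_, hdp, rfl⟩
  have hfT : s(c, d) ∉ T := by
    intro hf
    refine hd (hc.trans (Adj.reachable ?_))
    rw [fromEdgeSet_adj]
    exact ⟨⟨hf, fun h => he' (h ▸ hcd'.1)⟩, hcd'.2⟩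
  refine ⟨s(c, d), hcd'.1, hfT, ?_, ?_⟩
  · refine hT.exchange he hfT (hT'.1 hcd'.1) ?_
    have hle : fromEdgeSet (T \ {s(a, b)}) ≤ fromEdgeSet (insert s(c, d) (T \ {s(a, b)})) :=
      fromEdgeSet_mono (Set.subset_insert _ _)
    have hdb : (fromEdgeSet (T \ {s(a, b)})).Reachable d b :=
      (reachable_or_reachable_of_connected_fromEdgeSet hT.2.connected a b d).resolve_left
        fun h => hd h.symm
    have hadj : (fromEdgeSet (insert s(c, d) (T \ {s(a, b)}))).Adj c d := by
      rw [fromEdgeSet_adj]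
      exact ⟨Or.inl rfl, hcd'.2⟩
    exact ((hc.mono hle).trans hadj.reachable).trans (hdb.mono hle)
  · refine hT'.exchange hcd'.1 he' (hT.1 he) ?_
    have hsep' : ¬ (fromEdgeSet (T' \ {s(c, d)})).Reachable a b := by
      intro h
      obtain ⟨q, hq⟩ := h.exists_isPath
      have hle : fromEdgeSet (T' \ {s(c, d)}) ≤ fromEdgeSet T' :=
        fromEdgeSet_mono Set.sdiff_subset
      have hpq : p = q.mapLe hle := congrArg Subtype.val
        ((hT'.2.isAcyclic.subsingleton_path a b).elim ⟨p, hp⟩ ⟨q.mapLe hle, hq.mapLe hle⟩)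
      rw [hpq, Walk.edges_mapLe_eq_edges] at hfp
      exact ((fromEdgeSet_adj _).1 (q.edges_subset_edgeSet hfp)).1.2 rfl
    have hle : fromEdgeSet (T' \ {s(c, d)}) ≤ fromEdgeSet (insert s(a, b) (T' \ {s(c, d)})) :=
      fromEdgeSet_mono (Set.subset_insert _ _)
    have hab : (fromEdgeSet (insert s(a, b) (T' \ {s(c, d)}))).Reachable a b := by
      refine Adj.reachable ?_
      rw [fromEdgeSet_adj]
      exact ⟨Or.inl rfl, hne⟩
    rcases reachable_or_reachable_of_connected_fromEdgeSet hT'.2.connected c d a with ha | ha <;>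
    rcases reachable_or_reachable_of_connected_fromEdgeSet hT'.2.connected c d b with hb | hb
    · exact absurd (ha.trans hb.symm) hsep'
    · exact ((ha.mono hle).symm.trans hab).trans (hb.mono hle)
    · exact ((hb.mono hle).symm.trans hab.symm).trans (ha.mono hle)
    · exact absurd (ha.trans hb.symm) hsep'

/-- Summands of an extreme point of a Minkowski sum are extreme. -/
lemma Set.extremePoints_add_left {E : Type*} [AddCommGroup E] [Module ℝ E] {A B : Set E}
    {a b : E} (ha : a ∈ A) (hb : b ∈ B) (h : a + b ∈ (A + B).extremePoints ℝ) :
    a ∈ A.extremePoints ℝ := by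
  refine ⟨ha, fun x hx y hy hxy => ?_⟩
  have h' : a + b ∈ openSegment ℝ (x + b) (y + b) := by
    obtain ⟨s, t, hs, ht, hst, rfl⟩ := hxy
    refine ⟨s, t, hs, ht, hst, ?_⟩
    rw [smul_add, smul_add, add_add_add_comm, ← add_smul, hst, one_smul]
  exact add_right_cancel (h.2 (Set.add_mem_add hx hb) (Set.add_mem_add hy hb) h')

lemma Set.extremePoints_add_right {E : Type*} [AddCommGroup E] [Module ℝ E] {A B : Set E}
    {a b : E} (ha : a ∈ A) (hb : b ∈ B) (h : a + b ∈ (A + B).extremePoints ℝ) :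
    b ∈ B.extremePoints ℝ := by
  rw [add_comm a b, add_comm A B] at h
  exact Set.extremePoints_add_left hb ha h

lemma exists_smul_eq_sub_of_mem_segment {E : Type*} [AddCommGroup E] [Module ℝ E] {u v x : E}
    (hx : x ∈ segment ℝ u v) : ∃ t : ℝ, x - u = t • (v - u) := by
  rw [segment_eq_image'] at hx
  obtain ⟨t, -, rfl⟩ := hx
  exact ⟨t, by simp⟩

/-- If two points of `A` have the same midpoint as the ends of a segment that is extreme in `A`,
then they lie on the line through that segment. -/
lemma IsExtreme.exists_smul_eq_sub {E : Type*} [AddCommGroup E] [Module ℝ E] {A : Set E}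
    {u v x y : E} (h : IsExtreme ℝ A (segment ℝ u v)) (hx : x ∈ A) (hy : y ∈ A)
    (hxy : x + y = u + v) : ∃ t : ℝ, x - u = t • (v - u) := by
  refine exists_smul_eq_sub_of_mem_segment (h.left_mem_of_mem_openSegment hx hy
    (z := (1 / 2 : ℝ) • (u + v)) ?_ ?_)
  · exact ⟨1 / 2, 1 / 2, by norm_num, by norm_num, by norm_num, by rw [smul_add]⟩
  · exact ⟨1 / 2, 1 / 2, by norm_num, by norm_num, by norm_num, by rw [← hxy, smul_add]⟩

/-- The end of an extreme segment is an extreme point. -/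
lemma IsExtreme.left_mem_extremePoints {E : Type*} [AddCommGroup E] [Module ℝ E] {A : Set E}
    {u v : E} (h : IsExtreme ℝ A (segment ℝ u v)) : u ∈ A.extremePoints ℝ := by
  refine isExtreme_singleton.1 (h.trans (isExtreme_singleton.2 ⟨left_mem_segment ℝ u v, ?_⟩))
  intro x hx y hy hxy
  rw [segment_eq_image'] at hx hy
  obtain ⟨α, ⟨hα, -⟩, rfl⟩ := hx
  obtain ⟨β, ⟨hβ, -⟩, rfl⟩ := hy
  obtain ⟨s, t, hs, ht, hst, hu⟩ := hxy
  have hzero : (s * α + t * β) • (v - u) = 0 := by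
    have hsum : s • (u + α • (v - u)) + t • (u + β • (v - u)) =
        (s + t) • u + (s * α + t * β) • (v - u) := by module
    rwa [hsum, hst, one_smul, add_eq_left] at hu
  rcases smul_eq_zero.1 hzero with h0 | h0
  · have hα0 : α = 0 := by
      have := mul_nonneg ht.le hβ
      have := mul_nonneg hs.le hα
      exact (mul_eq_zero.1 (by linarith : s * α = 0)).resolve_left hs.ne'
    simp [hα0]
  · simp [h0]

lemma stdVec_injective {ι : Type*} : Function.Injective (stdVec (ι := ι)) := by
  intro i j h
  have := congrFun h i
  by_contra hij
  simp [stdVec, hij] at this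

lemma exists_smul_of_smul_eq {E : Type*} [AddCommGroup E] [Module ℝ E] {w d : E} {t : ℝ}
    (hw : w ≠ 0) (h : w = t • d) : ∃ c : ℝ, d = c • w := by
  have ht : t ≠ 0 := by
    rintro rfl
    exact hw (by simpa using h)
  exact ⟨t⁻¹, by rw [h, inv_smul_smul₀ ht]⟩

lemma coIndicator_exchange {V : Type*} {G : SimpleGraph V} {T : Set (Sym2 V)} {e f : G.edgeSet}
    (he : (e : Sym2 V) ∈ T) (hf : (f : Sym2 V) ∉ T) :
    coIndicator G (insert (f : Sym2 V) (T \ {(e : Sym2 V)})) =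
      coIndicator G T + (stdVec e - stdVec f) := by
  have hef : e ≠ f := fun h => hf (h ▸ he)
  ext x
  by_cases hxe : x = e
  · subst hxe
    simp [coIndicator, stdVec, he, hef, Subtype.coe_inj]
  · by_cases hxf : x = f
    · subst hxf
      simp [coIndicator, stdVec, hf, hxe]
    · simp [coIndicator, stdVec, hxe, hxf, Subtype.coe_inj]

/-- For a 2-edge-connected graph `G`, every edge (one-dimensional extreme
segment) of the Minkowski sum `P_F = P_U + Δ_E` is parallel to a difference `e_i − e_j`
of standard basis vectors with `i ≠ j`. -/
theorem massive_F_polytope_edges {V : Type*} [Fintype V] (G : SimpleGraph V)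
    (hconn : G.Connected)
    (h2ec : ∀ e ∈ G.edgeSet, (G.deleteEdges {e}).Connected)
    (u v : G.edgeSet → ℝ) (huv : u ≠ v)
    (hedge : IsExtreme ℝ
      ((convexHull ℝ {x : G.edgeSet → ℝ | ∃ T, IsSpanningTreeEdges G T ∧ x = coIndicator G T}) +
        convexHull ℝ {x : G.edgeSet → ℝ | ∃ f : G.edgeSet, x = stdVec f})
      (segment ℝ u v)) :
    ∃ i j : G.edgeSet, i ≠ j ∧ ∃ c : ℝ, v - u = c • (stdVec i - stdVec j) := by
  obtain ⟨p, hp, q, hq, rfl⟩ := Set.mem_add.1 (hedge.subset (left_mem_segment ℝ u v))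
  obtain ⟨p', hp', q', hq', rfl⟩ := Set.mem_add.1 (hedge.subset (right_mem_segment ℝ (p + q) v))
  have hu := hedge.left_mem_extremePoints
  have hv := (segment_symm ℝ (p + q) (p' + q') ▸ hedge).left_mem_extremePoints
  obtain ⟨i, rfl⟩ := extremePoints_convexHull_subset (Set.extremePoints_add_right hp hq hu)
  obtain ⟨j, rfl⟩ := extremePoints_convexHull_subset (Set.extremePoints_add_right hp' hq' hv)
  by_cases hij : i = j
  · subst hij
    obtain ⟨T, hT, rfl⟩ := extremePoints_convexHull_subset (Set.extremePoints_add_left hp hq hu)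
    obtain ⟨T', hT', rfl⟩ :=
      extremePoints_convexHull_subset (Set.extremePoints_add_left hp' hq' hv)
    have hnot : ¬ T ⊆ T' := fun hsub => huv <| by
      rw [Set.eq_of_subset_of_ncard_le hsub
        (Nat.le_of_succ_le_succ (hT'.ncard_add_one.trans hT.ncard_add_one.symm).le)]
    obtain ⟨e, he, he'⟩ := Set.not_subset.1 hnot
    obtain ⟨f, hf', hf, h1, h2⟩ := hT.symmetric_exchange hT' he he'
    lift e to G.edgeSet using hT.1 he
    lift f to G.edgeSet using hT'.1 hf'
    have hef : e ≠ f := fun h => hf (h ▸ he)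
    refine ⟨e, f, hef, ?_⟩
    obtain ⟨t, ht⟩ := hedge.exists_smul_eq_sub
      (Set.add_mem_add (subset_convexHull ℝ _ ⟨_, h1, rfl⟩) hq)
      (Set.add_mem_add (subset_convexHull ℝ _ ⟨_, h2, rfl⟩) hq)
      (by rw [coIndicator_exchange he hf, coIndicator_exchange hf' he']; abel)
    refine exists_smul_of_smul_eq (sub_ne_zero.2 (stdVec_injective.ne hef)) (t := t) ?_
    rw [← ht, coIndicator_exchange he hf]
    abel
  · refine ⟨j, i, Ne.symm hij, ?_⟩
    obtain ⟨t, ht⟩ := hedge.exists_smul_eq_sub (Set.add_mem_add hp hq')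
      (Set.add_mem_add hp' hq) (by abel)
    refine exists_smul_of_smul_eq (sub_ne_zero.2 (stdVec_injective.ne (Ne.symm hij))) (t := t) ?_
    rw [← ht]
    abel
end
end

section
/- Let G be a finite connected simple graph with edge set E that is 2-edge-connected. Let P_U = conv{1_{E∖T} : T a spanning tree of G} and P_{F0} = conv{1_{E∖F} : F a spanning two-forest of G} in ℝ^E. Then the Cayley sum P_U * P_{F0} = conv((P_U × {0}) ∪ (P_{F0} × {1})) ⊆ ℝ^E × ℝ has the integer decomposition property. -/
open scoped Pointwise
open Classical

noncomputable section

/-- The matroid whose independent sets are the `M`-independent sets of size at most `r`. -/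
def Matroid.truncation {α : Type*} [Finite α] (M : Matroid α) (r : ℕ) : Matroid α :=
  (IndepMatroid.ofFinite (Set.toFinite M.E) (fun I => M.Indep I ∧ I.ncard ≤ r)
    ⟨M.empty_indep, by simp⟩
    (fun _ _ hJ hIJ => ⟨hJ.1.subset hIJ, (Set.ncard_le_ncard hIJ (Set.toFinite _)).trans hJ.2⟩)
    (fun I J hI hJ hIJ => by
      have hlt : I.encard < J.encard := by
        rw [← (Set.toFinite I).cast_ncard_eq, ← (Set.toFinite J).cast_ncard_eq]
        exact_mod_cast hIJ
      obtain ⟨e, he, hins⟩ := hI.1.augment hJ.1 hlt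
      refine ⟨e, he.1, he.2, hins, ?_⟩
      rw [Set.ncard_insert_of_notMem he.2 (Set.toFinite _)]
      exact hIJ.trans_le hJ.2)
    (fun _ hI => hI.1.subset_ground)).matroid

/-- The number of members of the family `I` that contain `x`. -/
def coverCount {α ι : Type*} [Fintype ι] (I : ι → Set α) (x : α) : ℕ :=
  ∑ i, (I i).indicator (fun _ => 1) x

section MatroidPartition

variable {α ι : Type*} [Fintype ι]

lemma sum_coverCount (I : ι → Set α) (D : Finset α) :
    ∑ x ∈ D, coverCount I x = ∑ i, (I i ∩ D).ncard := by
  unfold coverCount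
  rw [Finset.sum_comm]
  refine Finset.sum_congr rfl fun i _ => ?_
  rw [Set.ncard_eq_toFinset_card', Finset.card_eq_sum_ones]
  simp only [Set.indicator_apply]
  rw [← Finset.sum_filter]
  exact Finset.sum_congr (by ext; simp [and_comm]) fun _ _ => rfl

lemma coverCount_update_insert {I : ι → Set α} {i : ι} {x : α} (hx : x ∉ I i) (w : α) :
    coverCount (Function.update I i (insert x (I i))) w =
      coverCount I w + if w = x then 1 else 0 := by
  unfold coverCount
  rw [← Finset.add_sum_erase _ _ (Finset.mem_univ i),
    ← Finset.add_sum_erase (f := fun i => (I i).indicator (fun _ => 1) w) _ (Finset.mem_univ i)]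
  have h : ∑ j ∈ Finset.univ.erase i,
      (Function.update I i (insert x (I i)) j).indicator (fun _ => 1) w =
      ∑ j ∈ Finset.univ.erase i, (I j).indicator (fun _ => 1) w :=
    Finset.sum_congr rfl fun j hj => by rw [Function.update_of_ne (Finset.ne_of_mem_erase hj)]
  rw [h, Function.update_self]
  by_cases hw : w = x
  · subst hw; simp [hx]; omega
  · simp [Set.indicator_apply, hw]

lemma coverCount_update_exchange {I : ι → Set α} {i : ι} {x z : α} (hx : x ∉ I i) (hz : z ∈ I i)
    (w : α) :
    coverCount (Function.update I i (insert x (I i) \ {z})) w + (if w = z then 1 else 0) =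
      coverCount I w + if w = x then 1 else 0 := by
  set J := Function.update I i (insert x (I i) \ {z}) with hJ
  have hzJ : z ∉ J i := by simp [hJ]
  rw [← coverCount_update_insert hx, ← coverCount_update_insert hzJ]
  congr 1
  simp [hJ, hz]

/-- One family is obtained from another by inserting into one member an element that is covered
too few times, and removing another element of that member, preserving independence. -/
def ExchangeStep (M : ι → Matroid α) (y : α → ℕ) (I J : ι → Set α) : Prop :=
  ∃ i x z, coverCount I x < y x ∧ x ∉ I i ∧ z ∈ I i ∧ (M i).Indep (insert x (I i) \ {z}) ∧
    J = Function.update I i (insert x (I i) \ {z})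

/-- `I` consists of independent sets covering each element `x` at most `y x` times. -/
def IsPacking (M : ι → Matroid α) (y : α → ℕ) (I : ι → Set α) : Prop :=
  (∀ i, (M i).Indep (I i)) ∧ ∀ x, coverCount I x ≤ y x

lemma ExchangeStep.isPacking {M : ι → Matroid α} {y : α → ℕ} {I J : ι → Set α}
    (h : ExchangeStep M y I J) (hI : IsPacking M y I) : IsPacking M y J := by
  obtain ⟨i, x, z, hxy, hx, hz, hind, rfl⟩ := h
  refine ⟨fun j => ?_, fun w => ?_⟩
  · by_cases hj : j = i
    · subst hj; simpa using hind
    · simpa [hj] using hI.1 j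
  · have h1 := coverCount_update_exchange hx hz w
    have h2 := hI.2 w
    by_cases hw : w = x
    · subst hw; simp only [if_true] at h1; split_ifs at h1 <;> omega
    · simp only [hw, if_false] at h1; omega

lemma IsPacking.coverCount_exchange_lt {M : ι → Matroid α} {y : α → ℕ} {I : ι → Set α}
    (hI : IsPacking M y I) {i : ι} {x z : α} (hx : x ∉ I i) (hz : z ∈ I i) :
    coverCount (Function.update I i (insert x (I i) \ {z})) z < y z := by
  have h := coverCount_update_exchange hx hz z
  have hne : z ≠ x := fun h => hx (h ▸ hz)
  have := hI.2 z
  simp only [if_true, hne, if_false] at h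
  omega

open Relation

/-- Elements covered too few times by a family reachable from `I` by exchanges. -/
def deficientSet (M : ι → Matroid α) (y : α → ℕ) (I : ι → Set α) : Set α :=
  {x | ∃ J, ReflTransGen (ExchangeStep M y) I J ∧ coverCount J x < y x}

lemma fundCircuit_subset_deficientSet {M : ι → Matroid α} {y : α → ℕ} {I J : ι → Set α}
    (hIJ : ReflTransGen (ExchangeStep M y) I J) (hJ : IsPacking M y J) {i : ι} {x : α}
    (hxy : coverCount J x < y x) (hx : x ∉ J i) (hcl : x ∈ (M i).closure (J i)) :
    (M i).fundCircuit x (J i) ⊆ deficientSet M y I := by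
  intro z hz
  by_cases hzx : z = x
  · subst hzx; exact ⟨J, hIJ, hxy⟩
  have hzJ : z ∈ J i := ((M i).fundCircuit_subset_insert _ _ hz).resolve_left hzx
  rw [(hJ.1 i).mem_fundCircuit_iff hcl hx] at hz
  exact ⟨_, hIJ.tail ⟨i, x, z, hxy, hx, hzJ, hz, rfl⟩, hJ.coverCount_exchange_lt hx hzJ⟩

variable [Fintype α]

lemma ExchangeStep.sum_coverCount_eq {M : ι → Matroid α} {y : α → ℕ} {I J : ι → Set α}
    (h : ExchangeStep M y I J) : ∑ x, coverCount J x = ∑ x, coverCount I x := by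
  obtain ⟨i, x, z, hxy, hx, hz, hind, rfl⟩ := h
  have := Finset.sum_congr (rfl : (Finset.univ : Finset α) = Finset.univ)
    fun w _ => coverCount_update_exchange hx hz w
  simpa [Finset.sum_add_distrib] using this

lemma mem_closure_of_maximal {M : ι → Matroid α} (hE : ∀ i, (M i).E = Set.univ) {y : α → ℕ}
    {J : ι → Set α} (hJ : IsPacking M y J)
    (hmax : ∀ K, IsPacking M y K → ∑ x, coverCount K x ≤ ∑ x, coverCount J x)
    {i : ι} {x : α} (hxy : coverCount J x < y x) : x ∈ (M i).closure (J i) := by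
  by_cases hx : x ∈ J i
  · exact (M i).mem_closure_of_mem hx (by simp [hE])
  by_contra hcl
  rw [(hJ.1 i).notMem_closure_iff_of_notMem hx (by simp [hE])] at hcl
  have hc := coverCount_update_insert (I := J) hx
  have hle := hmax (Function.update J i (insert x (J i))) ⟨fun j => ?_, fun w => ?_⟩
  · simp [hc, Finset.sum_add_distrib] at hle
  · by_cases hj : j = i
    · subst hj; simpa using hcl
    · simpa [hj] using hJ.1 j
  · rw [hc]
    have := hJ.2 w
    split_ifs with hw
    · subst hw; omega
    · simpa using this

lemma mem_closure_inter_deficientSet {M : ι → Matroid α} (hE : ∀ i, (M i).E = Set.univ)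
    {y : α → ℕ} {I J : ι → Set α} (hIJ : ReflTransGen (ExchangeStep M y) I J)
    (hJ : IsPacking M y J)
    (hmax : ∀ K, IsPacking M y K → ∑ x, coverCount K x ≤ ∑ x, coverCount J x)
    (i : ι) {x : α} (hxy : coverCount J x < y x) :
    x ∈ (M i).closure (J i ∩ deficientSet M y I) := by
  by_cases hx : x ∈ J i
  · exact (M i).mem_closure_of_mem ⟨hx, J, hIJ, hxy⟩ (by simp [hE])
  have hcl := mem_closure_of_maximal hE hJ hmax (i := i) hxy
  have hC := (hJ.1 i).fundCircuit_isCircuit hcl hx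
  refine (M i).closure_subset_closure ?_
    (hC.mem_closure_sdiff_singleton_of_mem ((M i).mem_fundCircuit x (J i)))
  rw [(M i).fundCircuit_sdiff_eq_inter hx, Set.inter_comm]
  exact Set.inter_subset_inter_right _ (fundCircuit_subset_deficientSet hIJ hJ hxy hx hcl)

lemma closure_inter_deficientSet_eq {M : ι → Matroid α} (hE : ∀ i, (M i).E = Set.univ)
    {y : α → ℕ} {I J : ι → Set α} (hI : IsPacking M y I)
    (hmax : ∀ K, IsPacking M y K → ∑ x, coverCount K x ≤ ∑ x, coverCount I x)
    (hIJ : ReflTransGen (ExchangeStep M y) I J) :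
    (IsPacking M y J ∧ ∑ x, coverCount J x = ∑ x, coverCount I x) ∧
      ∀ i, (M i).closure (J i ∩ deficientSet M y I) =
        (M i).closure (I i ∩ deficientSet M y I) := by
  induction hIJ with
  | refl => exact ⟨⟨hI, rfl⟩, fun _ => rfl⟩
  | @tail J K hIJ hJK ih =>
    obtain ⟨⟨hJ, hsum⟩, hcl⟩ := ih
    refine ⟨⟨hJK.isPacking hJ, hJK.sum_coverCount_eq.trans hsum⟩, fun j => ?_⟩
    rw [← hcl j]
    obtain ⟨i, x, z, hxy, hx, hz, hind, rfl⟩ := hJK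
    by_cases hj : j = i
    swap
    · simp [hj]
    subst hj
    have hmaxJ : ∀ K, IsPacking M y K → ∑ x, coverCount K x ≤ ∑ x, coverCount J x :=
      fun K hK => hsum ▸ hmax K hK
    have hxcl := mem_closure_of_maximal hE hJ hmaxJ (i := j) hxy
    have hxD : x ∈ deficientSet M y I := ⟨J, hIJ, hxy⟩
    have hzC : z ∈ (M j).fundCircuit x (J j) := ((hJ.1 j).mem_fundCircuit_iff hxcl hx).2 hind
    have hCD := fundCircuit_subset_deficientSet hIJ hJ hxy hx hxcl
    have hC := (hJ.1 j).fundCircuit_isCircuit hxcl hx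
    have hset : (insert x (J j) \ {z}) ∩ deficientSet M y I =
        insert x (J j ∩ deficientSet M y I) \ {z} := by
      ext w
      by_cases hw : w = x
      · subst hw; simp [hxD]
      · simp [hw]; tauto
    rw [Function.update_self, hset]
    refine ((hJ.1 j).subset Set.inter_subset_left).closure_insert_sdiff_eq_of_mem_closure
      (mem_closure_inter_deficientSet hE hIJ hJ hmaxJ j hxy)
      ((M j).closure_subset_closure ?_ (hC.mem_closure_sdiff_singleton_of_mem hzC))
    refine Set.sdiff_subset_sdiff_left fun w hw => ?_
    rcases (M j).fundCircuit_subset_insert _ _ hw with rfl | h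
    · exact Set.mem_insert _ _
    · exact Set.mem_insert_of_mem _ ⟨h, hCD hw⟩

/-- Matroid partition (Edmonds): if on every `D` the total multiplicity is at most the sum of the
ranks of `D`, then the multiset `y` is a union of independent sets, one for each matroid. -/
theorem exists_indep_coverCount_eq {M : ι → Matroid α} (hE : ∀ i, (M i).E = Set.univ) {y : α → ℕ}
    (hy : ∀ D : Finset α, ∃ B : ι → Set α, (∀ i, (M i).Indep (B i)) ∧
      ∑ x ∈ D, y x ≤ ∑ i, (B i ∩ D).ncard) :
    ∃ I : ι → Set α, (∀ i, (M i).Indep (I i)) ∧ ∀ x, coverCount I x = y x := by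
  obtain ⟨I, hI, hmax⟩ := Set.exists_max_image {I | IsPacking M y I}
    (fun I => ∑ x, coverCount I x) (Set.toFinite _)
    ⟨fun _ => ∅, fun i => (M i).empty_indep, fun x => by simp [coverCount]⟩
  refine ⟨I, hI.1, fun x₀ => (hI.2 x₀).antisymm ?_⟩
  by_contra! hx₀
  set D : Finset α := (deficientSet M y I).toFinset with hD
  have hDc : (D : Set α) = deficientSet M y I := by simp [hD]
  obtain ⟨B, hB, hle⟩ := hy D
  have hx₀D : x₀ ∈ D := by simpa [hD] using ⟨I, .refl, hx₀⟩
  have hlt : ∑ x ∈ D, coverCount I x < ∑ x ∈ D, y x :=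
    Finset.sum_lt_sum (fun x _ => hI.2 x) ⟨x₀, hx₀D, hx₀⟩
  rw [sum_coverCount] at hlt
  refine absurd (hle.trans (Finset.sum_le_sum fun i _ => ?_)) hlt.not_ge
  have hsub : B i ∩ D ⊆ (M i).closure (I i ∩ D) := by
    rintro x ⟨-, hx⟩
    rw [hDc] at hx ⊢
    obtain ⟨J, hIJ, hxy⟩ := hx
    obtain ⟨⟨hJ, hsum⟩, hcl⟩ := closure_inter_deficientSet_eq hE hI hmax hIJ
    rw [← hcl i]
    exact mem_closure_inter_deficientSet hE hIJ hJ (fun K hK => hsum ▸ hmax K hK) i hxy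
  have h := (M i).eRk_mono hsub
  rw [Matroid.eRk_closure_eq, ((hB i).subset Set.inter_subset_left).eRk_eq_encard,
    ((hI.1 i).subset Set.inter_subset_left).eRk_eq_encard,
    ← (Set.toFinite _).cast_ncard_eq, ← (Set.toFinite (I i ∩ D)).cast_ncard_eq] at h
  exact_mod_cast h

end MatroidPartition

section SpanningForests

open SimpleGraph

variable {V : Type*} {G : SimpleGraph V}

lemma SimpleGraph.eq_sup_edge_of_edgeSet_eq_insert {H T : SimpleGraph V} {u v : V}
    (h : T.edgeSet = insert s(u, v) H.edgeSet) : T = H ⊔ edge u v := by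
  have hadj : T.Adj u v := by rw [← mem_edgeSet, h]; exact Set.mem_insert _ _
  rw [← edgeSet_inj, h, edgeSet_sup, edgeSet_edge_of_ne hadj.ne, Set.union_comm]
  rfl

lemma SimpleGraph.Connected.exists_adj_not_reachable [Nonempty V] (hG : G.Connected)
    {H : SimpleGraph V} (hH : ¬ H.Connected) : ∃ u v, G.Adj u v ∧ ¬ H.Reachable u v := by
  by_contra! hcon
  refine hH ⟨fun u v => ?_⟩
  obtain ⟨p⟩ := hG.preconnected u v
  induction p with
  | nil => exact .refl _
  | cons h _ ih => exact (hcon _ _ h).trans ih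

/-- The spanning subgraph of `G` with edge set `I`. -/
def edgeSubgraph (I : Set G.edgeSet) : SimpleGraph V := fromEdgeSet (Subtype.val '' I)

lemma edgeSet_edgeSubgraph (I : Set G.edgeSet) :
    (edgeSubgraph I).edgeSet = Subtype.val '' I := by
  rw [edgeSubgraph, edgeSet_fromEdgeSet]
  refine sdiff_eq_left.2 (Set.disjoint_left.2 ?_)
  rintro _ ⟨e, -, rfl⟩
  exact G.not_isDiag_of_mem_edgeSet e.2

lemma edgeSubgraph_le (I : Set G.edgeSet) : edgeSubgraph I ≤ G := by
  rw [← edgeSet_subset_edgeSet, edgeSet_edgeSubgraph]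
  exact Subtype.coe_image_subset _ _

lemma edgeSubgraph_mono {I J : Set G.edgeSet} (h : I ⊆ J) : edgeSubgraph I ≤ edgeSubgraph J :=
  fromEdgeSet_mono (Set.image_mono h)

lemma ncard_edgeSet_edgeSubgraph (I : Set G.edgeSet) :
    (edgeSubgraph I).edgeSet.ncard = I.ncard := by
  rw [edgeSet_edgeSubgraph, Set.ncard_image_of_injective _ Subtype.val_injective]

lemma edgeSubgraph_insert (I : Set G.edgeSet) {u v : V} (h : G.Adj u v) :
    edgeSubgraph (insert ⟨s(u, v), h⟩ I) = edgeSubgraph I ⊔ edge u v :=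
  eq_sup_edge_of_edgeSet_eq_insert (by simp only [edgeSet_edgeSubgraph, Set.image_insert_eq])

lemma exists_insert_isAcyclic {I J : Set G.edgeSet} (hJ : (edgeSubgraph J).Connected)
    (hI : (edgeSubgraph I).IsAcyclic) (hIc : ¬ (edgeSubgraph I).Connected) :
    ∃ e ∈ J \ I, (edgeSubgraph (insert e I)).IsAcyclic := by
  have := hJ.nonempty
  obtain ⟨u, v, huv, hnr⟩ := hJ.exists_adj_not_reachable hIc
  have hG : G.Adj u v := edgeSubgraph_le J huv
  refine ⟨⟨s(u, v), hG⟩, ⟨?_, fun h => hnr (Adj.reachable ?_)⟩, ?_⟩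
  · rw [← mem_edgeSet, edgeSet_edgeSubgraph] at huv
    simpa [hG] using huv
  · rw [← mem_edgeSet, edgeSet_edgeSubgraph]
    exact ⟨_, h, rfl⟩
  · rw [edgeSubgraph_insert]
    exact hI.sup_edge_of_not_reachable hnr

lemma edgeSubgraph_univ : edgeSubgraph (Set.univ : Set G.edgeSet) = G := by
  rw [← edgeSet_inj, edgeSet_edgeSubgraph, Set.image_univ, Subtype.range_coe]

variable [Finite V]

lemma SimpleGraph.IsTree.ncard_edgeSet {T : SimpleGraph V} (hT : T.IsTree) :
    T.edgeSet.ncard + 1 = Nat.card V := by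
  have := Fintype.ofFinite V
  rw [Set.ncard_eq_toFinset_card', Nat.card_eq_fintype_card, ← hT.card_edgeFinset]
  rfl

lemma SimpleGraph.IsAcyclic.ncard_edgeSet_lt (hG : G.Connected) {H : SimpleGraph V}
    (hle : H ≤ G) (hH : H.IsAcyclic) : H.edgeSet.ncard + 1 ≤ Nat.card V := by
  obtain ⟨T, hHT, -, hT⟩ := hG.exists_isTree_le_of_le_of_isAcyclic hle hH
  rw [← hT.ncard_edgeSet]
  exact Nat.succ_le_succ (Set.ncard_le_ncard (edgeSet_mono hHT) (Set.toFinite _))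

lemma SimpleGraph.IsAcyclic.isTree_of_ncard_edgeSet (hG : G.Connected) {H : SimpleGraph V}
    (hle : H ≤ G) (hH : H.IsAcyclic) (hcard : H.edgeSet.ncard + 1 = Nat.card V) : H.IsTree := by
  obtain ⟨T, hHT, -, hT⟩ := hG.exists_isTree_le_of_le_of_isAcyclic hle hH
  have := Set.eq_of_subset_of_ncard_le (edgeSet_mono hHT)
    (by have := hT.ncard_edgeSet; omega) (Set.toFinite _)
  rwa [edgeSet_inj.1 this]

lemma SimpleGraph.IsAcyclic.ncard_edgeSet_of_card_connectedComponent_eq_two (hG : G.Connected)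
    {H : SimpleGraph V} (hH : H.IsAcyclic) (hc : Nat.card H.ConnectedComponent = 2) :
    H.edgeSet.ncard + 2 = Nat.card V := by
  have := hG.nonempty
  have hcon : ¬ H.Connected := fun h => by
    have := h.preconnected.subsingleton_connectedComponent
    have := Finite.card_le_one_iff_subsingleton.2 this
    omega
  obtain ⟨u, v, huv, hnr⟩ := hG.exists_adj_not_reachable hcon
  have hle : H ≤ H ⊔ edge u v := le_sup_left
  have hadj : (H ⊔ edge u v).Adj u v := by simp [edge_adj, huv.ne]
  have hne : H.connectedComponentMk u ≠ H.connectedComponentMk v := by simpa using hnr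
  have hreach : ∀ w, (H ⊔ edge u v).Reachable u w := by
    intro w
    obtain ⟨a, b, -, hab⟩ := Nat.card_eq_two_iff.1 hc
    have hall : ∀ c, c = a ∨ c = b := fun c => by
      have : c ∈ ({a, b} : Set H.ConnectedComponent) := hab ▸ Set.mem_univ c
      simpa using this
    have hw : H.connectedComponentMk u = H.connectedComponentMk w ∨
        H.connectedComponentMk v = H.connectedComponentMk w := by
      rcases hall (H.connectedComponentMk u) with h1 | h1 <;>
      rcases hall (H.connectedComponentMk v) with h2 | h2 <;>
      rcases hall (H.connectedComponentMk w) with h3 | h3 <;>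
      simp_all
    simp only [ConnectedComponent.eq] at hw
    exact hw.elim (·.mono hle) fun h => hadj.reachable.trans (h.mono hle)
  have htree : (H ⊔ edge u v).IsTree :=
    ⟨⟨fun a b => (hreach a).symm.trans (hreach b)⟩, hH.sup_edge_of_not_reachable hnr⟩
  have hnot : s(u, v) ∉ H.edgeSet := fun h => hnr (Adj.reachable h)
  rw [← htree.ncard_edgeSet, edgeSet_sup, edgeSet_edge_of_ne huv.ne, Set.union_singleton,
    Set.ncard_insert_of_notMem hnot (Set.toFinite _)]

lemma SimpleGraph.IsAcyclic.card_connectedComponent_eq_two (hG : G.Connected)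
    {H : SimpleGraph V} (hle : H ≤ G) (hH : H.IsAcyclic)
    (hcard : H.edgeSet.ncard + 2 = Nat.card V) : Nat.card H.ConnectedComponent = 2 := by
  obtain ⟨T, hHT, -, hT⟩ := hG.exists_isTree_le_of_le_of_isAcyclic hle hH
  have hTc := hT.ncard_edgeSet
  have hsub := edgeSet_mono hHT
  have hdiff := Set.ncard_sdiff_add_ncard_of_subset hsub (Set.toFinite _)
  obtain ⟨e, he⟩ := Set.ncard_eq_one.1 (show (T.edgeSet \ H.edgeSet).ncard = 1 by omega)
  induction e with | _ u v
  have hmem : s(u, v) ∈ T.edgeSet \ H.edgeSet := he ▸ rfl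
  have hT' := eq_sup_edge_of_edgeSet_eq_insert (H := H) (T := T) (u := u) (v := v) (by
    rw [Set.insert_eq, ← he, Set.sdiff_union_of_subset hsub])
  have hnr : ¬ H.Reachable u v := by
    have hb := isAcyclic_iff_forall_isBridge.1 hT.isAcyclic hmem.1
    rw [hT', isBridge_sup_edge, isBridge_iff] at hb
    rwa [deleteEdges_eq_self.2 (by simpa using hmem.2)] at hb
  have hstep : ∀ a b, T.Adj a b → H.Reachable a b ∨ (a = u ∨ a = v) := by
    intro a b hab
    rw [hT', sup_adj, edge_adj] at hab
    rcases hab with h | h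
    · exact .inl h.reachable
    · right; tauto
  have hQ : ∀ w z, T.Walk w z → z = u → H.Reachable w u ∨ H.Reachable w v := by
    intro w z p hz
    induction p with
    | nil => exact .inl (hz ▸ .refl _)
    | @cons a b _ h _ ih =>
      rcases hstep a b h with h | rfl | rfl
      · exact (ih hz).imp h.trans h.trans
      · exact .inl (.refl _)
      · exact .inr (.refl _)
  refine Nat.card_eq_two_iff.2 ⟨H.connectedComponentMk u, H.connectedComponentMk v, by simpa,
    Set.eq_univ_of_forall fun c => ?_⟩
  induction c using ConnectedComponent.ind with | _ w
  obtain ⟨p⟩ := hT.connected.preconnected w u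
  simpa using hQ w u p rfl

lemma maximal_isAcyclic_edgeSubgraph_iff (hG : G.Connected) {I : Set G.edgeSet}
    (hI : (edgeSubgraph I).IsAcyclic) :
    Maximal (fun I : Set G.edgeSet => (edgeSubgraph I).IsAcyclic) I ↔
      (edgeSubgraph I).Connected := by
  refine ⟨fun h => ?_, fun h => ⟨hI, fun J hJ hIJ => ?_⟩⟩
  · by_contra hc
    obtain ⟨e, he, hins⟩ := exists_insert_isAcyclic (J := Set.univ)
      (by rwa [edgeSubgraph_univ]) hI hc
    exact he.2 (h.2 hins (Set.subset_insert _ _) (Set.mem_insert _ _))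
  · have h1 := IsTree.ncard_edgeSet ⟨h, hI⟩
    have h2 := hJ.ncard_edgeSet_lt hG (edgeSubgraph_le J)
    rw [ncard_edgeSet_edgeSubgraph] at h1 h2
    exact (Set.eq_of_subset_of_ncard_le hIJ (by omega) (Set.toFinite _)).ge

/-- The cycle matroid of a connected finite graph: independent sets are forests. -/
def cycleMatroid (hG : G.Connected) : Matroid G.edgeSet :=
  (IndepMatroid.ofBdd Set.univ (fun I => (edgeSubgraph I).IsAcyclic)
    (by simp [edgeSubgraph])
    (fun _ _ hJ hIJ => hJ.anti (edgeSubgraph_mono hIJ))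
    (fun I J hI hImax hJmax => exists_insert_isAcyclic
      ((maximal_isAcyclic_edgeSubgraph_iff hG hJmax.1).1 hJmax) hI
      (fun h => hImax ((maximal_isAcyclic_edgeSubgraph_iff hG hI).2 h)))
    (fun _ _ => Set.subset_univ _)
    ⟨Nat.card G.edgeSet, fun I _ => by
      rw [← (Set.toFinite I).cast_ncard_eq]
      exact_mod_cast Set.ncard_le_card I⟩).matroid

lemma isSpanningTreeEdges_image (hG : G.Connected) {I : Set G.edgeSet}
    (hI : (edgeSubgraph I).IsAcyclic) (hcard : I.ncard + 1 = Nat.card V) :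
    IsSpanningTreeEdges G (Subtype.val '' I) :=
  ⟨Subtype.coe_image_subset _ _, hI.isTree_of_ncard_edgeSet hG (edgeSubgraph_le I)
    ((congrArg (· + 1) (ncard_edgeSet_edgeSubgraph I)).trans hcard)⟩

lemma isSpanningTwoForestEdges_image (hG : G.Connected) {I : Set G.edgeSet}
    (hI : (edgeSubgraph I).IsAcyclic) (hcard : I.ncard + 2 = Nat.card V) :
    IsSpanningTwoForestEdges G (Subtype.val '' I) :=
  ⟨Subtype.coe_image_subset _ _, hI, hI.card_connectedComponent_eq_two hG (edgeSubgraph_le I)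
    ((congrArg (· + 2) (ncard_edgeSet_edgeSubgraph I)).trans hcard)⟩

lemma IsSpanningTreeEdges.exists_eq_image {T : Set (Sym2 V)} (h : IsSpanningTreeEdges G T) :
    ∃ I : Set G.edgeSet, T = Subtype.val '' I ∧ (edgeSubgraph I).IsAcyclic ∧
      I.ncard + 1 = Nat.card V := by
  obtain ⟨I, rfl⟩ : ∃ I : Set G.edgeSet, T = Subtype.val '' I :=
    ⟨Subtype.val ⁻¹' T, by rw [Subtype.image_preimage_coe, Set.inter_eq_right.2 h.1]⟩
  refine ⟨I, rfl, h.2.isAcyclic, ?_⟩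
  rw [← ncard_edgeSet_edgeSubgraph]
  exact h.2.ncard_edgeSet

lemma IsSpanningTwoForestEdges.exists_eq_image (hG : G.Connected) {F : Set (Sym2 V)}
    (h : IsSpanningTwoForestEdges G F) :
    ∃ I : Set G.edgeSet, F = Subtype.val '' I ∧ (edgeSubgraph I).IsAcyclic ∧
      I.ncard + 2 = Nat.card V := by
  obtain ⟨I, rfl⟩ : ∃ I : Set G.edgeSet, F = Subtype.val '' I :=
    ⟨Subtype.val ⁻¹' F, by rw [Subtype.image_preimage_coe, Set.inter_eq_right.2 h.1]⟩
  refine ⟨I, rfl, h.2.1, ?_⟩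
  rw [← ncard_edgeSet_edgeSubgraph]
  exact IsAcyclic.ncard_edgeSet_of_card_connectedComponent_eq_two hG h.2.1 h.2.2

end SpanningForests

section IDP

variable {ι : Type*}

lemma IsLatticePt.add {x y : ι → ℝ} (hx : IsLatticePt x) (hy : IsLatticePt y) :
    IsLatticePt (x + y) := fun i => by
  obtain ⟨a, ha⟩ := hx i
  obtain ⟨b, hb⟩ := hy i
  exact ⟨a + b, by simp [ha, hb]⟩

lemma IsLatticePt.sum {κ : Type*} {s : Finset κ} {v : κ → ι → ℝ}
    (hv : ∀ i ∈ s, IsLatticePt (v i)) : IsLatticePt (∑ i ∈ s, v i) :=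
  Finset.sum_induction v IsLatticePt (fun _ _ => .add) (fun _ => ⟨0, by simp⟩) hv

lemma Convex.sum_mem_smul {P : Set (ι → ℝ)} (hP : Convex ℝ P) (hne : P.Nonempty) {n : ℕ}
    {v : Fin n → ι → ℝ} (hv : ∀ i, v i ∈ P) : ∑ i, v i ∈ (n : ℝ) • P := by
  rcases n.eq_zero_or_pos with rfl | hn
  · obtain ⟨p, hp⟩ := hne
    exact ⟨p, hp, by simp⟩
  · have hn' : (n : ℝ) ≠ 0 := by positivity
    refine ⟨∑ i, (n : ℝ)⁻¹ • v i, hP.sum_mem (fun _ _ => by positivity) ?_ (fun i _ => hv i), ?_⟩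
    · simp [hn']
    · simp only [← Finset.smul_sum]
      exact smul_inv_smul₀ hn' _

lemma hasIDP_of_forall_exists_sum {P : Set (ι → ℝ)} (hP : Convex ℝ P)
    (h : ∀ k : ℕ, ∀ p ∈ P, IsLatticePt ((k : ℝ) • p) →
      ∃ v : Fin k → ι → ℝ, (∀ i, v i ∈ P ∧ IsLatticePt (v i)) ∧ ∑ i, v i = (k : ℝ) • p) :
    HasIDP P := by
  intro k hk
  obtain ⟨n, rfl⟩ := Nat.exists_eq_add_of_le' hk
  rw [Nat.add_sub_cancel]
  refine Set.Subset.antisymm ?_ ?_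
  · rintro _ ⟨⟨p, hp, rfl⟩, hx⟩
    obtain ⟨v, hv, hs⟩ := h _ p hp hx
    refine ⟨∑ i : Fin n, v i.succ, ⟨hP.sum_mem_smul ⟨p, hp⟩ fun i => (hv _).1,
      IsLatticePt.sum fun i _ => (hv _).2⟩, v 0, hv 0, ?_⟩
    exact (add_comm _ _).trans ((Fin.sum_univ_succ v).symm.trans hs)
  · rintro _ ⟨a, ⟨ha, hal⟩, b, ⟨hb, hbl⟩, rfl⟩
    refine ⟨?_, hal.add hbl⟩
    rw [Nat.cast_add, Nat.cast_one, hP.add_smul n.cast_nonneg zero_le_one, one_smul]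
    exact ⟨a, ha, b, hb, rfl⟩

end IDP

section CayleySum

variable {V : Type*} {G : SimpleGraph V}

lemma coIndicator_image_apply (I : Set G.edgeSet) (e : G.edgeSet) :
    coIndicator G (Subtype.val '' I) e = 1 - I.indicator (fun _ => (1 : ℝ)) e := by
  by_cases h : e ∈ I <;> simp [coIndicator, h]

lemma sum_coIndicator_image (I : Set G.edgeSet) (D : Finset G.edgeSet) :
    ∑ e ∈ D, coIndicator G (Subtype.val '' I) e = D.card - (I ∩ D).ncard := by
  simp only [coIndicator_image_apply, Finset.sum_sub_distrib, Finset.sum_const, nsmul_eq_mul,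
    mul_one, Set.indicator_apply, Finset.sum_boole]
  have : I ∩ D = ↑(D.filter (· ∈ I)) := by ext; simp [and_comm]
  rw [this, Set.ncard_coe_finset]

/-- The Cayley sum `P_U * P_{F₀}` in `ℝ^E × ℝ`, the extra coordinate being indexed by `none`. -/
def cayleyPolytope (G : SimpleGraph V) : Set (Option G.edgeSet → ℝ) :=
  convexHull ℝ
    ((fun (p : G.edgeSet → ℝ) (o : Option G.edgeSet) => o.elim (0 : ℝ) p) ''
        (convexHull ℝ {x : G.edgeSet → ℝ | ∃ T, IsSpanningTreeEdges G T ∧ x = coIndicator G T}) ∪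
      (fun (p : G.edgeSet → ℝ) (o : Option G.edgeSet) => o.elim (1 : ℝ) p) ''
        (convexHull ℝ
          {x : G.edgeSet → ℝ | ∃ F, IsSpanningTwoForestEdges G F ∧ x = coIndicator G F}))

lemma elim_zero_coIndicator_mem_cayleyPolytope {T : Set (Sym2 V)}
    (hT : IsSpanningTreeEdges G T) :
    (fun o : Option G.edgeSet => o.elim (0 : ℝ) (coIndicator G T)) ∈ cayleyPolytope G :=
  subset_convexHull _ _ (.inl ⟨_, subset_convexHull _ _ ⟨T, hT, rfl⟩, rfl⟩)

lemma elim_one_coIndicator_mem_cayleyPolytope {F : Set (Sym2 V)}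
    (hF : IsSpanningTwoForestEdges G F) :
    (fun o : Option G.edgeSet => o.elim (1 : ℝ) (coIndicator G F)) ∈ cayleyPolytope G :=
  subset_convexHull _ _ (.inr ⟨_, subset_convexHull _ _ ⟨F, hF, rfl⟩, rfl⟩)

lemma isLatticePt_elim_coIndicator (c : ℤ) (S : Set (Sym2 V)) :
    IsLatticePt (fun o : Option G.edgeSet => o.elim (c : ℝ) (coIndicator G S))
  | none => ⟨c, rfl⟩
  | some e => by
    by_cases h : (e : Sym2 V) ∈ S
    · exact ⟨0, by simp [coIndicator, h]⟩
    · exact ⟨1, by simp [coIndicator, h]⟩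

lemma convex_setOf_sum_le (D : Finset G.edgeSet) (s r : ℝ) :
    Convex ℝ {p : G.edgeSet → ℝ | s * ∑ e ∈ D, p e ≤ r} := by
  simpa using convex_halfSpace_le
    (s • ∑ e ∈ D, LinearMap.proj (R := ℝ) (φ := fun _ => ℝ) e).isLinear r

/-- A linear inequality that is valid at the vertices of the Cayley sum is valid on all of it. -/
lemma le_of_mem_cayleyPolytope {q : Option G.edgeSet → ℝ} (hq : q ∈ cayleyPolytope G)
    (D : Finset G.edgeSet) (s c r : ℝ)
    (h0 : ∀ T, IsSpanningTreeEdges G T → s * ∑ e ∈ D, coIndicator G T e ≤ r)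
    (h1 : ∀ F, IsSpanningTwoForestEdges G F → s * ∑ e ∈ D, coIndicator G F e + c ≤ r) :
    s * ∑ e ∈ D, q (some e) + c * q none ≤ r := by
  have hconv : Convex ℝ {q : Option G.edgeSet → ℝ |
      s * ∑ e ∈ D, q (some e) + c * q none ≤ r} := by
    have := convex_halfSpace_le (s • ∑ e ∈ D, LinearMap.proj (R := ℝ) (φ := fun _ => ℝ) (some e)
      + c • LinearMap.proj (R := ℝ) (φ := fun _ : Option G.edgeSet => ℝ) none).isLinear r
    simpa using this
  refine convexHull_min (Set.union_subset ?_ ?_) hconv hq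
  · rintro _ ⟨p, hp, rfl⟩
    have : p ∈ {p : G.edgeSet → ℝ | s * ∑ e ∈ D, p e ≤ r} :=
      convexHull_min (by rintro _ ⟨T, hT, rfl⟩; exact h0 T hT) (convex_setOf_sum_le D s r) hp
    simpa using this
  · rintro _ ⟨p, hp, rfl⟩
    have : p ∈ {p : G.edgeSet → ℝ | s * ∑ e ∈ D, p e ≤ r - c} :=
      convexHull_min (by rintro _ ⟨F, hF, rfl⟩; exact le_sub_iff_add_le.2 (h1 F hF))
        (convex_setOf_sum_le D s (r - c)) hp
    simpa [le_sub_iff_add_le] using this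

variable [Finite V]

lemma le_of_mem_cayleyPolytope_of_isAcyclic (hG : G.Connected) {q : Option G.edgeSet → ℝ}
    (hq : q ∈ cayleyPolytope G) (D : Finset G.edgeSet) (s c r : ℝ)
    (h0 : ∀ I : Set G.edgeSet, (edgeSubgraph I).IsAcyclic → I.ncard + 1 = Nat.card V →
      s * (D.card - (I ∩ D).ncard) ≤ r)
    (h1 : ∀ I : Set G.edgeSet, (edgeSubgraph I).IsAcyclic → I.ncard + 2 = Nat.card V →
      s * (D.card - (I ∩ D).ncard) + c ≤ r) :
    s * ∑ e ∈ D, q (some e) + c * q none ≤ r := by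
  refine le_of_mem_cayleyPolytope hq D s c r (fun T hT => ?_) fun F hF => ?_
  · obtain ⟨I, rfl, hI, hcard⟩ := hT.exists_eq_image
    rw [sum_coIndicator_image]
    exact h0 I hI hcard
  · obtain ⟨I, rfl, hI, hcard⟩ := hF.exists_eq_image hG
    rw [sum_coIndicator_image]
    exact h1 I hI hcard

/-- The combinatorial core: `y` is a sum of indicators of `m` spanning two-forests and `j` spanning
trees as soon as it satisfies the inequalities valid for such sums. -/
lemma exists_forests_coverCount_eq (hG : G.Connected) [Fintype G.edgeSet] {m j : ℕ}
    {y : G.edgeSet → ℕ}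
    (h : ∀ (D : Finset G.edgeSet) (s c r : ℝ),
      (∀ I : Set G.edgeSet, (edgeSubgraph I).IsAcyclic → I.ncard + 1 = Nat.card V →
        s * (D.card - (I ∩ D).ncard) ≤ r) →
      (∀ I : Set G.edgeSet, (edgeSubgraph I).IsAcyclic → I.ncard + 2 = Nat.card V →
        s * (D.card - (I ∩ D).ncard) + c ≤ r) →
      s * ((m + j) * D.card - ∑ e ∈ D, (y e : ℝ)) + c * m ≤ (m + j) * r) :
    ∃ I : Fin m ⊕ Fin j → Set G.edgeSet,
      (∀ i, (edgeSubgraph (I i)).IsAcyclic) ∧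
      (∀ i, (I (.inl i)).ncard + 2 = Nat.card V) ∧
      (∀ i, (I (.inr i)).ncard + 1 = Nat.card V) ∧
      ∀ e, coverCount I e = y e := by
  set N := Nat.card V with hN
  have hN1 : 1 ≤ N := by
    have := hG.nonempty
    exact Nat.one_le_iff_ne_zero.2 Nat.card_pos.ne'
  have hN2 : 0 < m → 2 ≤ N := fun hm => by
    by_contra hlt
    have := h ∅ 0 1 0 (by simp) (fun I _ hI => by omega)
    have : (m : ℝ) ≤ 0 := by simpa using this
    exact hm.ne' (by exact_mod_cast this.antisymm m.cast_nonneg)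
  let M : Fin m ⊕ Fin j → Matroid G.edgeSet :=
    Sum.elim (fun _ => (cycleMatroid hG).truncation (N - 2)) (fun _ => cycleMatroid hG)
  obtain ⟨I, hI, hIy⟩ := exists_indep_coverCount_eq (M := M) (y := y)
    (by rintro (i | i) <;> rfl) (fun D => by
      obtain ⟨A, hA, hAmax⟩ := Set.exists_max_image {I | (cycleMatroid hG).Indep I}
        (fun I => (I ∩ D).ncard) (Set.toFinite _) ⟨∅, (cycleMatroid hG).empty_indep⟩
      obtain ⟨B, hB, hBmax⟩ := Set.exists_max_image
        {I | ((cycleMatroid hG).truncation (N - 2)).Indep I}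
        (fun I => (I ∩ D).ncard) (Set.toFinite _)
        ⟨∅, Matroid.empty_indep ((cycleMatroid hG).truncation (N - 2))⟩
      refine ⟨Sum.elim (fun _ => B) (fun _ => A), by rintro (i | i); exacts [hB, hA], ?_⟩
      have := h D (-1) ((A ∩ D).ncard - (B ∩ D).ncard) ((A ∩ D).ncard - D.card)
        (fun I hI _ => by
          have : ((I ∩ D).ncard : ℝ) ≤ (A ∩ D).ncard := by exact_mod_cast hAmax I hI
          linarith)
        (fun I hI hc => by
          have : ((I ∩ D).ncard : ℝ) ≤ (B ∩ D).ncard := by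
            exact_mod_cast hBmax I ⟨hI, by omega⟩
          linarith)
      have : ∑ e ∈ D, (y e : ℝ) ≤ m * (B ∩ D).ncard + j * (A ∩ D).ncard := by linarith
      simp only [Fintype.sum_sum_type, Sum.elim_inl, Sum.elim_inr, Finset.sum_const,
        Finset.card_univ, Fintype.card_fin, smul_eq_mul]
      exact_mod_cast this)
  have hle : ∀ i, (I i).ncard ≤ Sum.elim (fun _ => N - 2) (fun _ => N - 1) i := by
    rintro (i | i)
    · exact (hI (.inl i)).2
    · have := SimpleGraph.IsAcyclic.ncard_edgeSet_lt hG (edgeSubgraph_le _) (hI (.inr i))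
      rw [ncard_edgeSet_edgeSubgraph] at this
      exact Nat.le_sub_one_of_lt this
  have hsum : ∑ i, (I i).ncard = ∑ e, y e := by
    simpa [hIy] using (sum_coverCount I Finset.univ).symm
  have hlow := h Finset.univ 1 (-1) (Fintype.card G.edgeSet - (N - 1))
    (fun I _ hc => by
      have : (I.ncard : ℝ) + 1 = N := by exact_mod_cast hc
      simp; linarith)
    (fun I _ hc => by
      have : (I.ncard : ℝ) + 2 = N := by exact_mod_cast hc
      simp; linarith)
  have heq : ∑ i, (I i).ncard = ∑ i : Fin m ⊕ Fin j,
      Sum.elim (fun _ => N - 2) (fun _ => N - 1) i := by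
    refine (Finset.sum_le_sum fun i _ => hle i).antisymm ?_
    rw [hsum]
    simp only [Fintype.sum_sum_type, Sum.elim_inl, Sum.elim_inr, Finset.sum_const,
      Finset.card_univ, Fintype.card_fin, smul_eq_mul]
    have hm : (m : ℝ) * (N - 2 : ℕ) = m * (N - 2) := by
      rcases m.eq_zero_or_pos with rfl | hm
      · simp
      · rw [Nat.cast_sub (hN2 hm)]; simp
    have : (m : ℝ) * (N - 2 : ℕ) + j * (N - 1 : ℕ) ≤ ∑ e, (y e : ℝ) := by
      rw [hm, Nat.cast_sub hN1]
      simp only [Finset.card_univ] at hlow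
      push_cast
      linarith
    exact_mod_cast this
  have hall := (Finset.sum_eq_sum_iff_of_le fun i _ => hle i).1 heq
  refine ⟨I, ?_, fun i => ?_, fun i => ?_, hIy⟩
  · rintro (i | i)
    exacts [(hI (.inl i)).1, hI (.inr i)]
  · have h1 := hall (.inl i) (Finset.mem_univ _)
    have h2 := hN2 i.pos
    simp only [Sum.elim_inl] at h1
    omega
  · have h1 := hall (.inr i) (Finset.mem_univ _)
    simp only [Sum.elim_inr] at h1
    omega

lemma exists_sum_eq_of_mem_cayleyPolytope (hG : G.Connected) {k : ℕ}
    {q : Option G.edgeSet → ℝ} (hq : q ∈ cayleyPolytope G) (hl : IsLatticePt ((k : ℝ) • q)) :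
    ∃ v : Fin k → Option G.edgeSet → ℝ, (∀ i, v i ∈ cayleyPolytope G ∧ IsLatticePt (v i)) ∧
      ∑ i, v i = (k : ℝ) • q := by
  have := Fintype.ofFinite G.edgeSet
  have hnone0 : 0 ≤ q none := by
    simpa using le_of_mem_cayleyPolytope hq ∅ 0 (-1) 0 (by simp) (by simp)
  have hnone1 : q none ≤ 1 := by
    simpa using le_of_mem_cayleyPolytope hq ∅ 0 1 1 (by simp) (by simp)
  have hco : ∀ S e, coIndicator G S e ≤ 1 := fun S e => by
    rw [coIndicator]; split <;> norm_num
  have hsome : ∀ e, q (some e) ≤ 1 := fun e => by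
    simpa using le_of_mem_cayleyPolytope hq {e} 1 0 1 (by simp [hco]) (by simp [hco])
  have hk0 : (0 : ℝ) ≤ k := k.cast_nonneg
  obtain ⟨m, j, rfl, hm⟩ : ∃ m j : ℕ, k = m + j ∧ (k : ℝ) * q none = m := by
    obtain ⟨z, hz⟩ := hl none
    simp only [Pi.smul_apply, smul_eq_mul] at hz
    have h0 : (0 : ℝ) ≤ z := hz ▸ mul_nonneg hk0 hnone0
    lift z to ℕ using by exact_mod_cast h0
    have h1 : (z : ℝ) ≤ k := by
      have := mul_le_of_le_one_right hk0 hnone1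
      rw [hz] at this
      exact_mod_cast this
    obtain ⟨j, hj⟩ := Nat.exists_eq_add_of_le (Nat.cast_le.1 h1)
    exact ⟨z, j, hj, by exact_mod_cast hz⟩
  have hy : ∀ e, ∃ n : ℕ, ((m + j : ℕ) : ℝ) * q (some e) = (m + j : ℕ) - n := fun e => by
    obtain ⟨z, hz⟩ := hl (some e)
    simp only [Pi.smul_apply, smul_eq_mul] at hz
    have h1 : (z : ℝ) ≤ (m + j : ℕ) := hz ▸ mul_le_of_le_one_right hk0 (hsome e)
    obtain ⟨n, hn⟩ := Int.le.dest (show z ≤ (m + j : ℕ) by exact_mod_cast h1)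
    refine ⟨n, ?_⟩
    rw [hz, eq_sub_iff_add_eq]
    exact_mod_cast hn
  choose y hy using hy
  obtain ⟨I, hI, hI2, hI1, hIy⟩ := exists_forests_coverCount_eq hG (m := m) (j := j) (y := y)
    (fun D s c r h0 h1 => by
      have := mul_le_mul_of_nonneg_left
        (le_of_mem_cayleyPolytope_of_isAcyclic hG hq D s c r h0 h1) hk0
      rw [mul_add, mul_left_comm, Finset.mul_sum, Finset.sum_congr rfl fun e _ => hy e,
        mul_left_comm _ c, hm] at this
      simpa [mul_comm (D.card : ℝ), add_mul] using this)
  let w : Fin m ⊕ Fin j → Option G.edgeSet → ℝ := fun i o =>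
    o.elim ((Sum.elim (fun _ => 1) (fun _ => 0) i : ℤ) : ℝ)
      (coIndicator G (Subtype.val '' I i))
  have hw : ∀ i, w i ∈ cayleyPolytope G := by
    rintro (i | i)
    · simpa [w] using elim_one_coIndicator_mem_cayleyPolytope
        (isSpanningTwoForestEdges_image hG (hI _) (hI2 i))
    · simpa [w] using elim_zero_coIndicator_mem_cayleyPolytope
        (isSpanningTreeEdges_image hG (hI _) (hI1 i))
  refine ⟨fun i => w (finSumFinEquiv.symm i),
    fun i => ⟨hw _, isLatticePt_elim_coIndicator _ _⟩, ?_⟩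
  rw [finSumFinEquiv.symm.sum_comp w]
  ext (_ | e)
  · rw [Pi.smul_apply, smul_eq_mul, hm, Finset.sum_apply]
    simp [w]
  · have hc : ∑ i, (I i).indicator (fun _ => (1 : ℝ)) e = y e := by
      rw [← hIy e, coverCount, Nat.cast_sum]
      refine Finset.sum_congr rfl fun i _ => ?_
      by_cases h : e ∈ I i <;> simp [h]
    rw [Pi.smul_apply, smul_eq_mul, hy, ← hc, Finset.sum_apply]
    simp [w, coIndicator_image_apply, Finset.sum_sub_distrib]

end CayleySum

/-- For a 2-edge-connected graph `G`, the Cayley sum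
`P_U * P_{F₀} = conv((P_U × {0}) ∪ (P_{F₀} × {1})) ⊆ ℝ^E × ℝ` has the integer decomposition
property.  We realize `ℝ^E × ℝ` as `Option E → ℝ`, with the extra coordinate indexed by
`none`. -/
theorem cayley_sum_IDP {V : Type*} [Fintype V] (G : SimpleGraph V)
    (hconn : G.Connected)
    (h2ec : ∀ e ∈ G.edgeSet, (G.deleteEdges {e}).Connected) :
    HasIDP (convexHull ℝ
      ((fun (p : G.edgeSet → ℝ) (o : Option G.edgeSet) => o.elim (0 : ℝ) p) ''
          (convexHull ℝ {x : G.edgeSet → ℝ | ∃ T, IsSpanningTreeEdges G T ∧ x = coIndicator G T}) ∪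
        (fun (p : G.edgeSet → ℝ) (o : Option G.edgeSet) => o.elim (1 : ℝ) p) ''
          (convexHull ℝ
            {x : G.edgeSet → ℝ | ∃ F, IsSpanningTwoForestEdges G F ∧ x = coIndicator G F}))) := by
  exact hasIDP_of_forall_exists_sum (convex_convexHull _ _)
    fun _ _ hp hl => exists_sum_eq_of_mem_cayleyPolytope hconn hp hl
end
end
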